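/- Permutation symmetry of discounting: for any function g : Ω' → [0,1] and all x₁, x₂, y ∈ Ω', it holds that x₁ ⊠ (x₂ ⊠ y) = x₂ ⊠ (x₁ ⊠ y). -/

import Mathlib

noncomputable section

/-- The opinion space excluding dogmatic opinions. -/
def Omega' : Set (ℝ × ℝ × ℝ) :=
  {x | x.1 ∈ Set.Ico (0:ℝ) 1 ∧ x.2.1 ∈ Set.Ico (0:ℝ) 1 ∧ x.2.2 ∈ Set.Ioc (0:ℝ) 1 ∧
    x.1 + x.2.1 + x.2.2 = 1}

/-- The full uncertainty opinion U = (0,0,1). -/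
def Uop : ℝ × ℝ × ℝ := (0, 0, 1)

/-- The consensus operation ⊕. -/
def consensus (x y : ℝ × ℝ × ℝ) : ℝ × ℝ × ℝ :=
  ((x.2.2 * y.1 + y.2.2 * x.1) / (x.2.2 + y.2.2 - x.2.2 * y.2.2),
   (x.2.2 * y.2.1 + y.2.2 * x.2.1) / (x.2.2 + y.2.2 - x.2.2 * y.2.2),
   x.2.2 * y.2.2 / (x.2.2 + y.2.2 - x.2.2 * y.2.2))

/-- Scalar multiplication α·x of evidence. -/
def smulOp (α : ℝ) (x : ℝ × ℝ × ℝ) : ℝ × ℝ × ℝ :=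
  (α * x.1 / (α * (x.1 + x.2.1) + x.2.2),
   α * x.2.1 / (α * (x.1 + x.2.1) + x.2.2),
   x.2.2 / (α * (x.1 + x.2.1) + x.2.2))

/-- Positive evidence p(x) = c·x_b/x_u. -/
def pEv (c : ℝ) (x : ℝ × ℝ × ℝ) : ℝ := c * x.1 / x.2.2

/-- Negative evidence n(x) = c·x_d/x_u. -/
def nEv (c : ℝ) (x : ℝ × ℝ × ℝ) : ℝ := c * x.2.1 / x.2.2

/-- The new discounting rule x ⊠ y = g(x)·y. -/
def box (g : ℝ × ℝ × ℝ → ℝ) (x y : ℝ × ℝ × ℝ) : ℝ × ℝ × ℝ := smulOp (g x) y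

/-- Subjective Logic discounting x ⊗ y. -/
def otimesSL (x y : ℝ × ℝ × ℝ) : ℝ × ℝ × ℝ :=
  (x.1 * y.1, x.1 * y.2.1, x.2.1 + x.2.2 + x.1 * y.2.2)

theorem smulOp_denom_pos {α : ℝ} (hα : 0 ≤ α) {x : ℝ × ℝ × ℝ} (hx : x ∈ Omega') :
    0 < α * (x.1 + x.2.1) + x.2.2 :=
  add_pos_of_nonneg_of_pos (mul_nonneg hα (add_nonneg hx.1.1 hx.2.1.1)) hx.2.2.1.1

theorem smulOp_smulOp (α : ℝ) {β : ℝ} {x : ℝ × ℝ × ℝ}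
    (h : β * (x.1 + x.2.1) + x.2.2 ≠ 0) :
    smulOp α (smulOp β x) = smulOp (α * β) x := by
  have hden : α * (β * x.1 / (β * (x.1 + x.2.1) + x.2.2) +
      β * x.2.1 / (β * (x.1 + x.2.1) + x.2.2)) + x.2.2 / (β * (x.1 + x.2.1) + x.2.2) =
      (α * β * (x.1 + x.2.1) + x.2.2) / (β * (x.1 + x.2.1) + x.2.2) := by
    ring
  simp only [smulOp, hden, ← mul_div_assoc, ← mul_assoc, div_div_div_cancel_right₀ h]

theorem stmt12 (g : ℝ × ℝ × ℝ → ℝ) (hg : ∀ x ∈ Omega', g x ∈ Set.Icc (0:ℝ) 1)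
    (x1 x2 y : ℝ × ℝ × ℝ) (hx1 : x1 ∈ Omega') (hx2 : x2 ∈ Omega') (hy : y ∈ Omega') :
    box g x1 (box g x2 y) = box g x2 (box g x1 y) := by
  simp only [box]
  rw [smulOp_smulOp _ (smulOp_denom_pos (hg x2 hx2).1 hy).ne',
    smulOp_smulOp _ (smulOp_denom_pos (hg x1 hx1).1 hy).ne', mul_comm]
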